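/- arXiv:1708.08087 — 2 statements merged into one kernel-verified Lean document; each statement's English description precedes it below -/
import Mathlib

section
/- Let a₀⁰, a₁⁰, a₀¹, a₁¹, x₀ be real numbers with a₁¹ ≠ 0, D := (a₁⁰ + a₀¹)² − 4·a₀⁰·a₁¹ ≥ 0 and √D ≥ a₁⁰ + a₀¹ + 2·a₁¹·x₀. Then the Riccati ODE A'(t) = a₀⁰ + (a₁⁰ + a₀¹)·A(t) + a₁¹·A(t)², A(0) = x₀, has a solution defined on all of [0,∞); i.e. there exists a differentiable function A : [0,∞) → ℝ with A(0) = x₀ satisfying the equation for every t ≥ 0 (the solution does not explode in finite time). -/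
lemma exists_expPrimitive (s : ℝ) (hs : 0 ≤ s) : ∃ E : ℝ → ℝ, E 0 = 0 ∧ (∀ t, 0 ≤ t → 0 ≤ E t) ∧
    ∀ t, HasDerivAt E (Real.exp (s * t)) t := by
  rcases hs.eq_or_lt with h | h
  · subst h
    exact ⟨fun t => t, rfl, fun t ht => ht, fun t => by simpa using hasDerivAt_id' t⟩
  · refine ⟨fun t => (Real.exp (s * t) - 1) / s, by simp, fun t ht => ?_, fun t => ?_⟩
    · have : 1 ≤ Real.exp (s * t) := Real.one_le_exp (by positivity)
      exact div_nonneg (by linarith) h.le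
    · have h1 := ((((hasDerivAt_id t).const_mul s).exp).sub_const 1).div_const s
      refine HasDerivAt.congr_deriv h1 ?_
      simp only [id, mul_one]
      field_simp

/-- Non-explosion criterion for the Riccati ODE
`A' = a₀⁰ + (a₁⁰ + a₀¹) A + a₁¹ A²`, `A 0 = x₀`: if `a₁¹ ≠ 0`,
`D = (a₁⁰ + a₀¹)² − 4 a₀⁰ a₁¹ ≥ 0` and `√D ≥ a₁⁰ + a₀¹ + 2 a₁¹ x₀`,
then a global solution on `[0,∞)` exists. -/
theorem stmt_6 (a00 a10 a01 a11 x0 : ℝ) (ha11 : a11 ≠ 0)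
    (D : ℝ) (hD : D = (a10 + a01) ^ 2 - 4 * a00 * a11) (hDnonneg : 0 ≤ D)
    (hcrit : a10 + a01 + 2 * a11 * x0 ≤ Real.sqrt D) :
    ∃ A : ℝ → ℝ, A 0 = x0 ∧ ∀ t : ℝ, 0 ≤ t →
      HasDerivWithinAt A (a00 + (a10 + a01) * A t + a11 * (A t) ^ 2) (Set.Ici 0) t := by
  have hsq : Real.sqrt D ^ 2 = D := Real.sq_sqrt hDnonneg
  have hs := Real.sqrt_nonneg D
  generalize Real.sqrt D = s at *
  generalize a10 + a01 = b at *
  obtain ⟨E, hE0, hEn, hE⟩ := exists_expPrimitive s hs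
  obtain ⟨w, hw⟩ : ∃ w, w = b + 2 * a11 * x0 - s := ⟨_, rfl⟩
  have hw0 : w ≤ 0 := by linarith
  refine ⟨fun t => (s + w * Real.exp (s * t) / (1 - w / 2 * E t) - b) / (2 * a11), ?_, ?_⟩
  · simp only [hE0, mul_zero, Real.exp_zero, sub_zero, hw]
    field_simp
    ring
  · intro t ht
    have hu : 1 - w / 2 * E t ≠ 0 := by
      have := mul_nonneg (neg_nonneg.2 hw0) (hEn t ht)
      have : 0 < 1 - w / 2 * E t := by linarith
      exact this.ne'
    have he := (((hasDerivAt_id t).const_mul s).exp).const_mul w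
    have hd := ((hE t).const_mul (w / 2)).const_sub 1
    have h1 := (((he.div hd hu).const_add s).sub_const b).div_const (2 * a11)
    refine HasDerivAt.hasDerivWithinAt ?_
    refine HasDerivAt.congr_deriv h1 ?_
    simp only [id, mul_one]
    have ha : a00 = (b ^ 2 - s ^ 2) / (4 * a11) := by
      rw [hsq, hD]; field_simp; ring
    rw [ha]
    generalize Real.exp (s * t) = e at *
    generalize 1 - w / 2 * E t = u at *
    field_simp
    ring
end

section
/- Let k be a natural number and g : ℝ → ℝ a bounded continuously differentiable function such that g(u)·e^{−u²/2}·H̄_{k+1}(u) → 0 as u → ±∞ and u ↦ |g'(u) − u·g(u)| is Lebesgue integrable on ℝ, and assume u ↦ g(u)·H̄_k(u)·e^{−u²/2} is integrable. Then |∫_ℝ g(u)·H̄_k(u)·e^{−u²/2} du| ≤ (2k+2)^{−1/2} · ∫_ℝ |g'(u) − u·g(u)| du. -/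
open MeasureTheory Filter

/-- Physicists' Hermite polynomial via the Rodrigues formula:
`H_n(x) = (−1)ⁿ e^{x²} (dⁿ/dxⁿ)(e^{−x²})`. -/
noncomputable def physHermite (n : ℕ) (x : ℝ) : ℝ :=
  (-1) ^ n * Real.exp (x ^ 2) * iteratedDeriv n (fun y => Real.exp (-y ^ 2)) x

/-- Normalized Hermite polynomial `H̄_n = (2ⁿ n! √π)^{−1/2} H_n`. -/
noncomputable def normHermite (n : ℕ) (x : ℝ) : ℝ :=
  ((2 ^ n * n.factorial * Real.sqrt Real.pi : ℝ) ^ (-(1 / 2) : ℝ)) * physHermite n x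

theorem hg_contDiff : ContDiff ℝ (⊤ : ℕ∞) (fun y : ℝ => Real.exp (-y ^ 2)) := by
  fun_prop

theorem hg_hasDerivAt (n : ℕ) (x : ℝ) :
    HasDerivAt (iteratedDeriv n (fun y : ℝ => Real.exp (-y ^ 2)))
      (iteratedDeriv (n + 1) (fun y : ℝ => Real.exp (-y ^ 2)) x) x := by
  rw [iteratedDeriv_succ]
  apply DifferentiableAt.hasDerivAt
  have h := hg_contDiff.differentiable_iteratedDeriv n (by exact_mod_cast WithTop.coe_lt_top n)
  exact h x

theorem hg_one (x : ℝ) : iteratedDeriv 1 (fun y : ℝ => Real.exp (-y ^ 2)) x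
    = -2 * x * Real.exp (-x ^ 2) := by
  rw [iteratedDeriv_one]
  have h : HasDerivAt (fun y : ℝ => Real.exp (-y ^ 2)) (Real.exp (-x ^ 2) * (-(2 * x))) x := by
    have := ((hasDerivAt_pow 2 x).neg).exp
    simpa using this
  rw [h.deriv]; ring

theorem hg_rec (n : ℕ) : ∀ x : ℝ, iteratedDeriv (n + 2) (fun y : ℝ => Real.exp (-y ^ 2)) x
    = -2 * x * iteratedDeriv (n + 1) (fun y : ℝ => Real.exp (-y ^ 2)) x
      - 2 * (n + 1) * iteratedDeriv n (fun y : ℝ => Real.exp (-y ^ 2)) x := by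
  induction n with
  | zero =>
    intro x
    have h1 := hg_hasDerivAt 1 x
    have h2 : iteratedDeriv 1 (fun y : ℝ => Real.exp (-y ^ 2))
        = fun x => -2 * x * iteratedDeriv 0 (fun y : ℝ => Real.exp (-y ^ 2)) x := by
      funext y; rw [hg_one]; simp
    have h3 : HasDerivAt (fun x => -2 * x * iteratedDeriv 0 (fun y : ℝ => Real.exp (-y ^ 2)) x)
      (-2 * 1 * iteratedDeriv 0 (fun y : ℝ => Real.exp (-y ^ 2)) x +
        -2 * x * iteratedDeriv 1 (fun y : ℝ => Real.exp (-y ^ 2)) x) x :=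
      (((hasDerivAt_id x).const_mul (-2))).mul (hg_hasDerivAt 0 x)
    rw [← h2] at h3
    have := h1.unique h3
    simp only [Nat.zero_add, Nat.cast_zero] at this ⊢
    rw [this]; ring
  | succ n ih =>
    intro x
    have h1 := hg_hasDerivAt (n + 2) x
    have h2 := funext ih
    have h3 := ((((hasDerivAt_id x).const_mul (-2))).mul (hg_hasDerivAt (n + 1) x)).sub
      ((hg_hasDerivAt n x).const_mul (2 * ((n : ℝ) + 1)))
    rw [h2] at h1
    have := h1.unique h3
    rw [this]; push_cast; simp only [id]; ring

theorem physHermite_hasDerivAt (n : ℕ) (x : ℝ) :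
    HasDerivAt (physHermite (n + 1)) (2 * (n + 1) * physHermite n x) x := by
  have h1 : HasDerivAt (fun y : ℝ => (-1 : ℝ) ^ (n + 1) * Real.exp (y ^ 2))
      ((-1) ^ (n + 1) * (Real.exp (x ^ 2) * (2 * x))) x := by
    have := ((hasDerivAt_pow 2 x).exp).const_mul ((-1 : ℝ) ^ (n + 1))
    simpa using this
  have h2 := h1.mul (hg_hasDerivAt (n + 1) x)
  refine h2.congr_deriv ?_
  rw [hg_rec, physHermite, pow_succ]
  ring

theorem normHermite_hasDerivAt (n : ℕ) (x : ℝ) :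
    HasDerivAt (normHermite (n + 1)) (Real.sqrt (2 * n + 2) * normHermite n x) x := by
  refine ((physHermite_hasDerivAt n x).const_mul _).congr_deriv ?_
  unfold normHermite
  have e : (2 ^ (n + 1) * (n + 1).factorial * Real.sqrt Real.pi : ℝ)
      = (2 * n + 2) * (2 ^ n * n.factorial * Real.sqrt Real.pi) := by
    rw [Nat.factorial_succ]; push_cast; ring
  have hp : (0 : ℝ) < 2 * n + 2 := by positivity
  rw [e, Real.mul_rpow hp.le (by positivity), Real.rpow_neg hp.le, ← Real.sqrt_eq_rpow]
  have hs := Real.mul_self_sqrt hp.le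
  have hs0 : Real.sqrt (2 * n + 2) ≠ 0 := (Real.sqrt_pos.2 hp).ne'
  set S := Real.sqrt (2 * n + 2) with hS
  have hi : S⁻¹ * (2 * (n : ℝ) + 2) = S := by
    rw [← hs, ← mul_assoc, inv_mul_cancel₀ hs0, one_mul]
  set A := (2 ^ n * n.factorial * Real.sqrt Real.pi : ℝ) ^ (-(1 / 2) : ℝ)
  linear_combination (A * physHermite n x) * hi

theorem physHermite_zero (x : ℝ) : physHermite 0 x = 1 := by
  simp [physHermite, ← Real.exp_add]

theorem physHermite_one (x : ℝ) : physHermite 1 x = 2 * x := by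
  rw [physHermite, hg_one]
  have : Real.exp (x ^ 2) * Real.exp (-x ^ 2) = 1 := by simp [← Real.exp_add]
  linear_combination (2 * x) * this

theorem physHermite_two (x : ℝ) : physHermite 2 x = 4 * x ^ 2 - 2 := by
  have h := hg_rec 0 x
  simp only [Nat.zero_add] at h
  rw [physHermite, h, hg_one]
  have : Real.exp (x ^ 2) * Real.exp (-x ^ 2) = 1 := by simp [← Real.exp_add]
  simp only [iteratedDeriv_zero, Nat.cast_zero]
  linear_combination (4 * x ^ 2 - 2) * this

/-- reduction of the bound to a squared inequality -/
theorem bound_of_sq (n : ℕ) (x : ℝ)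
    (h : (physHermite n x * Real.exp (-x ^ 2 / 2)) ^ 2 ≤ 2 ^ n * n.factorial * Real.sqrt Real.pi) :
    |normHermite n x| * Real.exp (-x ^ 2 / 2) ≤ 1 := by
  have hp : (0 : ℝ) < 2 ^ n * n.factorial * Real.sqrt Real.pi := by positivity
  have e : |normHermite n x| * Real.exp (-x ^ 2 / 2)
      = |(2 ^ n * n.factorial * Real.sqrt Real.pi : ℝ) ^ (-(1 / 2) : ℝ)
        * (physHermite n x * Real.exp (-x ^ 2 / 2))| := by
    rw [normHermite, ← mul_assoc, abs_mul _ (Real.exp _), abs_of_pos (Real.exp_pos _)]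
  rw [e, ← sq_le_one_iff_abs_le_one, mul_pow, Real.rpow_neg hp.le, ← Real.sqrt_eq_rpow, inv_pow,
    Real.sq_sqrt hp.le, inv_mul_le_iff₀ hp]
  linarith

theorem main_of_bound (k : ℕ) (g : ℝ → ℝ) (hg : ContDiff ℝ 1 g)
    (hb : ∀ u, |normHermite (k + 1) u| * Real.exp (-u ^ 2 / 2) ≤ 1)
    (hlim_top : Tendsto (fun u => g u * Real.exp (-u ^ 2 / 2) * normHermite (k + 1) u)
      atTop (nhds 0))
    (hlim_bot : Tendsto (fun u => g u * Real.exp (-u ^ 2 / 2) * normHermite (k + 1) u)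
      atBot (nhds 0))
    (hint : Integrable (fun u => |deriv g u - u * g u|))
    (hint1 : Integrable (fun u => g u * normHermite k u * Real.exp (-u ^ 2 / 2))) :
    |∫ u : ℝ, g u * normHermite k u * Real.exp (-u ^ 2 / 2)|
      ≤ (Real.sqrt (2 * k + 2))⁻¹ * ∫ u : ℝ, |deriv g u - u * g u| := by
  have hHc : Continuous (normHermite (k + 1)) :=
    continuous_iff_continuousAt.2 fun x => (normHermite_hasDerivAt k x).continuousAt
  have hgd : ∀ u, HasDerivAt g (deriv g u) u := fun u =>
    (hg.differentiable (by norm_num) u).hasDerivAt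
  have hdc : Continuous (deriv g) := hg.continuous_deriv (by norm_num)
  have hgc := hg.continuous
  have hptw : ∀ u, ‖(deriv g u - u * g u) * (normHermite (k + 1) u * Real.exp (-u ^ 2 / 2))‖
      ≤ |deriv g u - u * g u| := by
    intro u
    rw [Real.norm_eq_abs, abs_mul, abs_mul, abs_of_pos (Real.exp_pos _)]
    exact mul_le_of_le_one_right (abs_nonneg _) (hb u)
  have hI : Integrable (fun u =>
      (deriv g u - u * g u) * (normHermite (k + 1) u * Real.exp (-u ^ 2 / 2))) := by
    refine hint.mono' (Continuous.aestronglyMeasurable (by fun_prop)) (ae_of_all _ hptw)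
  have hd : ∀ u, HasDerivAt (fun u => g u * Real.exp (-u ^ 2 / 2) * normHermite (k + 1) u)
      ((deriv g u - u * g u) * (normHermite (k + 1) u * Real.exp (-u ^ 2 / 2))
        + Real.sqrt (2 * k + 2) * (g u * normHermite k u * Real.exp (-u ^ 2 / 2))) u := by
    intro u
    have he : HasDerivAt (fun u : ℝ => Real.exp (-u ^ 2 / 2)) (Real.exp (-u ^ 2 / 2) * (-u)) u := by
      have := (((hasDerivAt_pow 2 u).neg).div_const 2).exp
      refine this.congr_deriv ?_
      simp; ring
    refine (((hgd u).mul he).mul (normHermite_hasDerivAt k u)).congr_deriv ?_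
    simp only [Pi.mul_apply]
    ring
  have key := integral_of_hasDerivAt_of_tendsto hd (hI.add (hint1.const_mul _)) hlim_bot hlim_top
  rw [integral_add hI (hint1.const_mul _), integral_const_mul, sub_zero] at key
  have hp : (0 : ℝ) < Real.sqrt (2 * k + 2) := Real.sqrt_pos.2 (by positivity)
  have hle := norm_integral_le_of_norm_le hint (ae_of_all _ hptw)
  rw [eq_neg_of_add_eq_zero_left key, norm_neg, norm_mul, Real.norm_eq_abs,
    Real.norm_eq_abs, abs_of_pos hp] at hle
  rw [le_inv_mul_iff₀ hp]
  exact hle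

theorem cos_gap {a b : ℝ} (ha : 0 ≤ a) (hab : a ≤ b) (hb : b ≤ Real.pi) :
    2 * Real.sin ((b - a) / 2) ^ 2 ≤ Real.cos a - Real.cos b := by
  rw [Real.cos_sub_cos]
  have h1 : 0 ≤ Real.sin ((b - a) / 2) :=
    Real.sin_nonneg_of_nonneg_of_le_pi (by linarith) (by linarith)
  have h2 : Real.sin ((b - a) / 2) ≤ Real.sin ((a + b) / 2) := by
    have : 0 ≤ Real.sin ((a + b) / 2) - Real.sin ((b - a) / 2) := by
      rw [Real.sin_sub_sin]
      have e1 : ((a + b) / 2 - (b - a) / 2) / 2 = a / 2 := by ring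
      have e2 : ((a + b) / 2 + (b - a) / 2) / 2 = b / 2 := by ring
      rw [e1, e2]
      have := Real.sin_nonneg_of_nonneg_of_le_pi (x := a / 2) (by linarith) (by linarith)
      have := Real.cos_nonneg_of_neg_pi_div_two_le_of_le (x := b / 2) (by linarith) (by linarith)
      positivity
    linarith
  have e : (a - b) / 2 = -((b - a) / 2) := by ring
  rw [e, Real.sin_neg]
  nlinarith

theorem angle_bound {p r : ℝ} (hp : 0 ≤ p) (hp' : p ≤ Real.pi / 2) (hr : 0 < r)
    (hr' : r ≤ 0.904) : 2 * p * r ≤ 3 / 4 * r ^ 2 + 9 / 4 * Real.sin p ^ 2 := by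
  rcases le_total p 1.17 with h | h
  · have hs := Real.sin_ge_sub_cube hp
    have h1 : 0.7718 * p ≤ Real.sin p := by
      have : p ^ 2 ≤ 1.3689 := by nlinarith
      nlinarith
    have h2 : p ≤ 1.299 * Real.sin p := by nlinarith
    have h3 : 2 * p * r ≤ 2 * (1.299 * Real.sin p) * r := by gcongr
    nlinarith [sq_nonneg (r - 1.732 * Real.sin p), sq_nonneg (Real.sin p)]
  · have h0 : 0 ≤ Real.pi / 2 - p := by linarith
    have hpi := Real.pi_lt_d4
    have hc : Real.cos p ≤ Real.pi / 2 - p := by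
      rw [← Real.sin_pi_div_two_sub]
      exact Real.sin_le h0
    have hc0 : 0 ≤ Real.cos p := Real.cos_nonneg_of_neg_pi_div_two_le_of_le (by linarith) hp'
    have hsq := Real.sin_sq_add_cos_sq p
    have hm : (0.904 - r) * (2 * p - 0.75 * (r + 0.904)) ≥ 0 :=
      mul_nonneg (by linarith) (by linarith)
    set q := Real.pi / 2 - p with hq
    have hq1 : q ≤ 0.401 := by linarith
    have hcq : Real.cos p ^ 2 ≤ q ^ 2 := by gcongr
    have hpq : p = Real.pi / 2 - q := by linarith
    nlinarith [mul_nonneg h0 (by linarith : 0 ≤ 0.401 - q)]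

theorem set_vol (x R r s : ℝ) (hR : 0 < R) (hr : 0 < r) (hr' : r ≤ 0.904) (hrR : r ^ 2 * R = 1)
    (hs : 0 ≤ s) :
    volume {t : ℝ | t ∈ Set.Icc 0 Real.pi ∧ |x - 2 * R * Real.cos t| < s}
      ≤ ENNReal.ofReal (r * (3 / 4 + 9 / 8 * s)) := by
  refine (Real.volume_le_diam _).trans ?_
  have key : ∀ a b : ℝ, 0 ≤ a → a ≤ b → b ≤ Real.pi → |x - 2 * R * Real.cos a| < s →
      |x - 2 * R * Real.cos b| < s → b - a ≤ r * (3 / 4 + 9 / 8 * s) := by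
    intro a b ha hab hb h1 h2
    have hg := cos_gap ha hab hb
    have hb' := angle_bound (p := (b - a) / 2) (by linarith) (by linarith) hr hr'
    rw [abs_lt] at h1 h2
    have h3 : R * (Real.cos a - Real.cos b) ≤ s := by nlinarith
    have h4 : R * (2 * Real.sin ((b - a) / 2) ^ 2) ≤ s :=
      (mul_le_mul_of_nonneg_left hg hR.le).trans h3
    have h5 : 2 * Real.sin ((b - a) / 2) ^ 2 ≤ r ^ 2 * s := by
      calc 2 * Real.sin ((b - a) / 2) ^ 2 = r ^ 2 * (R * (2 * Real.sin ((b - a) / 2) ^ 2)) := by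
            rw [← mul_assoc, hrR, one_mul]
        _ ≤ _ := by gcongr
    have h6 : (b - a) * r ≤ (r * (3 / 4 + 9 / 8 * s)) * r := by nlinarith
    exact le_of_mul_le_mul_right h6 hr
  refine Metric.ediam_le ?_
  rintro a ⟨⟨ha, ha'⟩, ha2⟩ b ⟨⟨hb, hb'⟩, hb2⟩
  rw [edist_dist, Real.dist_eq]
  apply ENNReal.ofReal_le_ofReal
  rcases le_total a b with h | h
  · rw [abs_sub_comm, abs_of_nonneg (by linarith)]
    exact key a b ha h hb' ha2 hb2
  · rw [abs_of_nonneg (by linarith)]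
    exact key b a hb h ha' hb2 ha2

theorem tail_int (a : ℝ) (ha : 0 ≤ a) :
    IntegrableOn (fun s : ℝ => s * Real.exp (-s ^ 2 / 2)) (Set.Ioi a) ∧
    ∫ s in Set.Ioi a, s * Real.exp (-s ^ 2 / 2) = Real.exp (-a ^ 2 / 2) := by
  have hd : ∀ x ∈ Set.Ici a, HasDerivAt (fun s : ℝ => -Real.exp (-s ^ 2 / 2))
      (x * Real.exp (-x ^ 2 / 2)) x := by
    intro x _
    have := ((((hasDerivAt_pow 2 x).neg).div_const 2).exp).neg
    refine this.congr_deriv ?_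
    simp; ring
  have ht : Tendsto (fun s : ℝ => -Real.exp (-s ^ 2 / 2)) atTop (nhds (-0)) := by
    apply Tendsto.neg
    apply Real.tendsto_exp_atBot.comp
    have : Tendsto (fun s : ℝ => s ^ 2 / 2) atTop atTop :=
      (tendsto_pow_atTop (by norm_num)).atTop_div_const (by norm_num)
    refine (tendsto_neg_atTop_atBot.comp this).congr fun s => ?_
    simp; ring
  have hpos : ∀ x ∈ Set.Ioi a, 0 ≤ x * Real.exp (-x ^ 2 / 2) := fun x hx =>
    mul_nonneg (ha.trans (le_of_lt hx)) (Real.exp_pos _).le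
  refine ⟨integrableOn_Ioi_deriv_of_nonneg' hd hpos ht, ?_⟩
  rw [integral_Ioi_of_hasDerivAt_of_nonneg' hd hpos ht]
  simp

theorem second_int :
    IntegrableOn (fun s : ℝ => s ^ 2 * Real.exp (-s ^ 2 / 2)) (Set.Ioi 0) ∧
    ∫ s in Set.Ioi (0 : ℝ), s ^ 2 * Real.exp (-s ^ 2 / 2) = Real.sqrt (Real.pi / 2) := by
  have e : ∀ s : ℝ, s ^ (2 : ℝ) * Real.exp (-(1 / 2) * s ^ (2 : ℝ))
      = s ^ 2 * Real.exp (-s ^ 2 / 2) := by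
    intro s
    rw [Real.rpow_two]; congr 2; ring
  have h1 := integrableOn_rpow_mul_exp_neg_mul_rpow (p := 2) (s := 2) (b := 1 / 2)
    (by norm_num) (by norm_num) (by norm_num)
  have h2 := integral_rpow_mul_exp_neg_mul_rpow (p := 2) (q := 2) (b := 1 / 2)
    (by norm_num) (by norm_num) (by norm_num)
  simp only [e] at h1 h2
  refine ⟨h1, ?_⟩
  rw [h2]
  have hG : Real.Gamma ((2 + 1) / 2) = Real.sqrt Real.pi / 2 := by
    have := Real.Gamma_add_one (s := 1 / 2) (by norm_num)
    rw [Real.Gamma_one_half_eq] at this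
    rw [show ((2 : ℝ) + 1) / 2 = 1 / 2 + 1 by norm_num, this]; ring
  rw [hG]
  have h3 : (1 / 2 : ℝ) ^ (-(2 + 1) / 2 : ℝ) = 2 * Real.sqrt 2 := by
    rw [one_div, Real.inv_rpow (by norm_num), ← Real.rpow_neg (by norm_num),
      show (-(-(2 + 1) / 2) : ℝ) = 1 + 1 / 2 by norm_num, Real.rpow_add (by norm_num),
      Real.rpow_one, Real.sqrt_eq_rpow]
  rw [h3, Real.sqrt_div Real.pi_pos.le]
  have : Real.sqrt 2 ≠ 0 := by positivity
  have h4 := Real.mul_self_sqrt (show (0 : ℝ) ≤ 2 by norm_num)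
  field_simp
  linarith

theorem angle_integral (x R r : ℝ) (hR : 0 < R) (hr : 0 < r) (hr' : r ≤ 0.904)
    (hrR : r ^ 2 * R = 1) :
    ∫ t in (0 : ℝ)..Real.pi, Real.exp (-(x - 2 * R * Real.cos t) ^ 2 / 2)
      ≤ r * (3 / 4 + 9 / 8 * Real.sqrt (Real.pi / 2)) := by
  rw [intervalIntegral.integral_of_le Real.pi_pos.le, ← integral_Icc_eq_integral_Ioc]
  set U : ℝ → ℝ := fun t => |x - 2 * R * Real.cos t| with hU
  have hUc : Continuous U := by fun_prop
  have hUm := hUc.measurable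
  have e1 : ∀ t, ENNReal.ofReal (Real.exp (-(x - 2 * R * Real.cos t) ^ 2 / 2))
      = ∫⁻ s in Set.Ioi (0 : ℝ), (if U t < s then ENNReal.ofReal (s * Real.exp (-s ^ 2 / 2)) else 0) := by
    intro t
    have h0 : 0 ≤ U t := abs_nonneg _
    obtain ⟨hi, hv⟩ := tail_int (U t) h0
    rw [show (x - 2 * R * Real.cos t) ^ 2 = U t ^ 2 from (sq_abs _).symm, ← hv,
      ofReal_integral_eq_lintegral_ofReal hi]
    · have : (fun s => if U t < s then ENNReal.ofReal (s * Real.exp (-s ^ 2 / 2)) else 0)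
        = (Set.Ioi (U t)).indicator (fun s => ENNReal.ofReal (s * Real.exp (-s ^ 2 / 2))) := by
        funext s; simp [Set.indicator]
      rw [this, lintegral_indicator measurableSet_Ioi,
        Measure.restrict_restrict measurableSet_Ioi,
        Set.inter_eq_left.2 (Set.Ioi_subset_Ioi h0)]
    · filter_upwards [ae_restrict_mem measurableSet_Ioi] with s hs
      exact mul_nonneg (h0.trans (le_of_lt hs)) (Real.exp_pos _).le
  have hmeas : Measurable (Function.uncurry fun (t s : ℝ) =>
      if U t < s then ENNReal.ofReal (s * Real.exp (-s ^ 2 / 2)) else 0) := by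
    apply Measurable.ite
    · exact measurableSet_lt (hUm.comp measurable_fst) measurable_snd
    · fun_prop
    · exact measurable_const
  obtain ⟨hi1, hv1⟩ := tail_int 0 le_rfl
  obtain ⟨hi2, hv2⟩ := second_int
  have hii : IntegrableOn (fun s : ℝ => r * (3 / 4 * (s * Real.exp (-s ^ 2 / 2))
        + 9 / 8 * (s ^ 2 * Real.exp (-s ^ 2 / 2)))) (Set.Ioi 0) :=
    ((hi1.const_mul _).add (hi2.const_mul _)).const_mul _
  have hvv : ∫ s in Set.Ioi (0 : ℝ), r * (3 / 4 * (s * Real.exp (-s ^ 2 / 2))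
        + 9 / 8 * (s ^ 2 * Real.exp (-s ^ 2 / 2)))
      = r * (3 / 4 + 9 / 8 * Real.sqrt (Real.pi / 2)) := by
    rw [integral_const_mul, integral_add (hi1.const_mul _) (hi2.const_mul _),
      integral_const_mul, integral_const_mul, hv1, hv2]
    simp
  have hmain : ∫⁻ t in Set.Icc 0 Real.pi,
      ENNReal.ofReal (Real.exp (-(x - 2 * R * Real.cos t) ^ 2 / 2))
      ≤ ENNReal.ofReal (r * (3 / 4 + 9 / 8 * Real.sqrt (Real.pi / 2))) := by
    simp_rw [e1]
    rw [lintegral_lintegral_swap hmeas.aemeasurable, ← hvv,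
      ofReal_integral_eq_lintegral_ofReal hii]
    · apply setLIntegral_mono' measurableSet_Ioi
      intro s hs
      have hs0 : 0 ≤ s := le_of_lt hs
      have : (fun t => if U t < s then ENNReal.ofReal (s * Real.exp (-s ^ 2 / 2)) else 0)
        = ({t | U t < s}).indicator (fun _ => ENNReal.ofReal (s * Real.exp (-s ^ 2 / 2))) := by
        funext t; simp [Set.indicator]
      have hm : MeasurableSet {t | U t < s} := measurableSet_lt hUm measurable_const
      rw [this, lintegral_indicator_const hm, Measure.restrict_apply hm]
      have hv := set_vol x R r s hR hr hr' hrR hs0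
      have hset : {t | U t < s} ∩ Set.Icc 0 Real.pi
          = {t : ℝ | t ∈ Set.Icc 0 Real.pi ∧ |x - 2 * R * Real.cos t| < s} := by
        ext t; simp only [Set.mem_inter_iff, Set.mem_ofPred_eq, hU]; tauto
      rw [hset]
      calc _ ≤ ENNReal.ofReal (s * Real.exp (-s ^ 2 / 2))
            * ENNReal.ofReal (r * (3 / 4 + 9 / 8 * s)) := by gcongr
        _ = _ := by
          rw [← ENNReal.ofReal_mul (by positivity)]
          congr 1; ring
    · filter_upwards [ae_restrict_mem measurableSet_Ioi] with s hs
      have hs0 : 0 ≤ s := le_of_lt hs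
      simp only [Pi.zero_apply]
      positivity
  rw [integral_eq_lintegral_of_nonneg_ae (ae_of_all _ fun t => (Real.exp_pos _).le)
    (Continuous.aestronglyMeasurable (by fun_prop))]
  exact ENNReal.toReal_le_of_le_ofReal (by positivity) hmain

theorem hgc_diff : Differentiable ℂ (fun z : ℂ => Complex.exp (-z ^ 2)) := by fun_prop

theorem hg_re (n : ℕ) : iteratedDeriv n (fun y : ℝ => Real.exp (-y ^ 2))
    = fun x : ℝ => (iteratedDeriv n (fun z : ℂ => Complex.exp (-z ^ 2)) (x : ℂ)).re := by
  induction n with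
  | zero =>
    funext x
    simp only [iteratedDeriv_zero]
    rw [← Complex.ofReal_pow, ← Complex.ofReal_neg, Complex.exp_ofReal_re]
  | succ n ih =>
    funext x
    have h1 := hg_hasDerivAt n x
    rw [ih] at h1
    have hd : ContDiff ℂ (⊤ : ℕ∞) (fun z : ℂ => Complex.exp (-z ^ 2)) := by fun_prop
    have h2 := (hd.differentiable_iteratedDeriv n
      (by exact_mod_cast WithTop.coe_lt_top n) (x : ℂ)).hasDerivAt
    rw [← iteratedDeriv_succ] at h2
    exact h1.unique h2.real_of_complex

theorem norm_gauss_circle (x R t : ℝ) :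
    ‖Complex.exp (-(circleMap (x : ℂ) R t) ^ 2)‖
      = Real.exp (R ^ 2) * Real.exp (-x ^ 2 / 2) * Real.exp (-(x + 2 * R * Real.cos t) ^ 2 / 2) := by
  rw [Complex.norm_exp, ← Real.exp_add, ← Real.exp_add]
  congr 1
  have hz : circleMap (x : ℂ) R t = ((x + R * Real.cos t : ℝ) : ℂ)
      + ((R * Real.sin t : ℝ) : ℂ) * Complex.I := by
    rw [circleMap, Complex.exp_mul_I]; push_cast; ring
  rw [hz, Complex.neg_re, sq, Complex.mul_re]
  simp only [Complex.add_re, Complex.add_im, Complex.ofReal_re, Complex.ofReal_im,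
    Complex.re_ofReal_mul, Complex.im_ofReal_mul, Complex.I_re, Complex.I_im]
  have := Real.sin_sq_add_cos_sq t
  linear_combination R ^ 2 * this

theorem circle_split (x R K : ℝ)
    (hK : ∀ y, ∫ t in (0 : ℝ)..Real.pi, Real.exp (-(y - 2 * R * Real.cos t) ^ 2 / 2) ≤ K) :
    ∫ t in (0 : ℝ)..(2 * Real.pi), Real.exp (-(x + 2 * R * Real.cos t) ^ 2 / 2) ≤ 2 * K := by
  have hc : Continuous (fun t => Real.exp (-(x + 2 * R * Real.cos t) ^ 2 / 2)) := by fun_prop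
  rw [← intervalIntegral.integral_add_adjacent_intervals (b := Real.pi)
    (hc.intervalIntegrable _ _) (hc.intervalIntegrable _ _)]
  have h1 := hK (-x)
  have h2 := hK x
  have e1 : ∀ t, (-x - 2 * R * Real.cos t) ^ 2 = (x + 2 * R * Real.cos t) ^ 2 := fun t => by ring
  simp only [e1] at h1
  have e2 : ∫ t in Real.pi..(2 * Real.pi), Real.exp (-(x + 2 * R * Real.cos t) ^ 2 / 2)
      = ∫ t in (0 : ℝ)..Real.pi, Real.exp (-(x - 2 * R * Real.cos t) ^ 2 / 2) := by
    have := intervalIntegral.integral_comp_add_right (a := 0) (b := Real.pi)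
      (fun t => Real.exp (-(x + 2 * R * Real.cos t) ^ 2 / 2)) Real.pi
    rw [zero_add, ← two_mul] at this
    rw [← this]
    congr 1
    funext t
    rw [Real.cos_add_pi]; congr 3; ring
  linarith

theorem phys_bound (n : ℕ) (x R K : ℝ) (hR : 0 < R)
    (hK : ∀ y, ∫ t in (0 : ℝ)..Real.pi, Real.exp (-(y - 2 * R * Real.cos t) ^ 2 / 2) ≤ K) :
    |physHermite n x * Real.exp (-x ^ 2 / 2)|
      ≤ n.factorial * (R ^ n)⁻¹ * Real.exp (R ^ 2) * (K / Real.pi) := by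
  have hcau := (hgc_diff.differentiableOn (s := Metric.closedBall (x : ℂ) R)
    ).circleIntegral_one_div_sub_center_pow_smul hR n
  have hnorm : ‖∮ z in C((x : ℂ), R), (1 / (z - x) ^ (n + 1)) • Complex.exp (-z ^ 2)‖
      ≤ (R ^ n)⁻¹ * (Real.exp (R ^ 2) * Real.exp (-x ^ 2 / 2)) * (2 * K) := by
    rw [circleIntegral]
    refine (intervalIntegral.norm_integral_le_integral_norm Real.two_pi_pos.le).trans ?_
    have e : ∀ t : ℝ, ‖deriv (circleMap (x : ℂ) R) t • (1 / (circleMap (x : ℂ) R t - x) ^ (n + 1)) •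
        Complex.exp (-(circleMap (x : ℂ) R t) ^ 2)‖
        = (R ^ n)⁻¹ * (Real.exp (R ^ 2) * Real.exp (-x ^ 2 / 2))
          * Real.exp (-(x + 2 * R * Real.cos t) ^ 2 / 2) := by
      intro t
      rw [norm_smul, norm_smul, norm_gauss_circle, deriv_circleMap, circleMap_sub_center]
      simp only [norm_mul, norm_circleMap_zero, Complex.norm_I, norm_div, norm_one, norm_pow,
        abs_of_pos hR]
      field_simp
      ring
    simp only [e]
    rw [intervalIntegral.integral_const_mul]
    exact mul_le_mul_of_nonneg_left (circle_split x R K hK) (by positivity)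
  rw [hcau, norm_smul] at hnorm
  have hn2 : ‖(2 * Real.pi * Complex.I / n.factorial : ℂ)‖ = 2 * Real.pi / n.factorial := by
    simp [abs_of_pos Real.pi_pos]
  rw [hn2] at hnorm
  have hre : |iteratedDeriv n (fun y : ℝ => Real.exp (-y ^ 2)) x|
      ≤ ‖iteratedDeriv n (fun z : ℂ => Complex.exp (-z ^ 2)) (x : ℂ)‖ := by
    rw [hg_re]; exact Complex.abs_re_le_norm _
  have hf : (0 : ℝ) < n.factorial := by positivity
  have hpi := Real.pi_pos
  have h3 : |iteratedDeriv n (fun y : ℝ => Real.exp (-y ^ 2)) x|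
      ≤ n.factorial * (R ^ n)⁻¹ * (Real.exp (R ^ 2) * Real.exp (-x ^ 2 / 2)) * (K / Real.pi) := by
    refine hre.trans ?_
    have h4 : (0 : ℝ) < 2 * Real.pi / n.factorial := by positivity
    rw [← mul_le_mul_iff_right₀ h4]
    refine hnorm.trans (le_of_eq ?_)
    field_simp
  rw [physHermite, abs_mul, abs_mul, abs_mul, abs_pow, abs_neg, abs_one, one_pow, one_mul,
    abs_of_pos (Real.exp_pos _), abs_of_pos (Real.exp_pos _)]
  have h5 : Real.exp (x ^ 2) * Real.exp (-x ^ 2 / 2) * Real.exp (-x ^ 2 / 2) = 1 := by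
    rw [← Real.exp_add, ← Real.exp_add, Real.exp_eq_one_iff]; ring
  calc _ = (Real.exp (x ^ 2) * Real.exp (-x ^ 2 / 2))
        * |iteratedDeriv n (fun y : ℝ => Real.exp (-y ^ 2)) x| := by ring
    _ ≤ (Real.exp (x ^ 2) * Real.exp (-x ^ 2 / 2)) * (n.factorial * (R ^ n)⁻¹
        * (Real.exp (R ^ 2) * Real.exp (-x ^ 2 / 2)) * (K / Real.pi)) := by gcongr
    _ = _ := by linear_combination (n.factorial * (R ^ n)⁻¹ * Real.exp (R ^ 2) * (K / Real.pi)) * h5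

theorem stirling_three (n : ℕ) (hn : 3 ≤ n) : Stirling.stirlingSeq n ≤ 1.8225 := by
  obtain ⟨m, rfl⟩ : ∃ m, n = m + 1 := ⟨n - 1, by omega⟩
  have h := Stirling.stirlingSeq'_antitone (show 2 ≤ m by omega)
  simp only [Function.comp] at h
  refine h.trans ?_
  rw [Stirling.stirlingSeq]
  have he := Real.exp_one_lt_d9
  have he0 := Real.exp_pos 1
  have h6 : (2.4494 : ℝ) ≤ Real.sqrt (2 * ((Nat.succ 2 : ℕ) : ℝ)) := by
    apply Real.le_sqrt_of_sq_le; norm_num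
  have he3 : (3 / Real.exp 1) ^ 3 ≥ (3 / 2.7182818286) ^ 3 := by gcongr
  have hf : ((Nat.factorial (Nat.succ 2) : ℕ) : ℝ) = 6 := by norm_num [Nat.factorial]
  rw [hf]
  have hc : (((Nat.succ 2 : ℕ) : ℝ) / Real.exp 1) ^ (Nat.succ 2) = (3 / Real.exp 1) ^ 3 := by
    norm_num
  rw [hc, div_le_iff₀ (by positivity)]
  have : (2.4494 : ℝ) * (3 / 2.7182818286) ^ 3
      ≤ Real.sqrt (2 * ((Nat.succ 2 : ℕ) : ℝ)) * (3 / Real.exp 1) ^ 3 := by gcongr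
  refine le_trans ?_ (mul_le_mul_of_nonneg_left this (by norm_num))
  norm_num

theorem hermite_bound_large (n : ℕ) (hn : 3 ≤ n) (x : ℝ) :
    |normHermite n x| * Real.exp (-x ^ 2 / 2) ≤ 1 := by
  apply bound_of_sq
  have hn3 : (3 : ℝ) ≤ n := by exact_mod_cast hn
  have hn0 : (0 : ℝ) < n := by linarith
  set R := Real.sqrt (n / 2) with hRdef
  have hR : 0 < R := Real.sqrt_pos.2 (by positivity)
  have hR2 : R ^ 2 = n / 2 := Real.sq_sqrt (by positivity)
  set r := (Real.sqrt R)⁻¹ with hrdef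
  have hr : 0 < r := by positivity
  have hrR : r ^ 2 * R = 1 := by
    rw [hrdef, inv_pow, Real.sq_sqrt hR.le]; exact inv_mul_cancel₀ hR.ne'
  have hr' : r ≤ 0.904 := by
    by_contra! hlt
    have h1 : (0.904 : ℝ) ^ 2 < r ^ 2 := by gcongr
    have h2 : (1.2247 : ℝ) ≤ R := by
      apply Real.le_sqrt_of_sq_le; norm_num; linarith
    nlinarith
  set K0 := 3 / 4 + 9 / 8 * Real.sqrt (Real.pi / 2) with hK0
  have hb := phys_bound n x R (r * K0) hR
    (fun y => angle_integral y R r hR hr hr' hrR)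
  have hpi1 := Real.pi_gt_d4
  have hpi2 := Real.pi_lt_d4
  have hpi := Real.pi_pos
  have hK1 : K0 ≤ 2.1604 := by
    have : Real.sqrt (Real.pi / 2) ≤ 1.2534 := by
      rw [Real.sqrt_le_left (by norm_num)]; norm_num; linarith
    rw [hK0]; linarith
  have hK00 : 0 < K0 := by positivity
  have hst := stirling_three n hn
  have hsq := sq_le_sq' (by linarith [abs_nonneg (physHermite n x * Real.exp (-x ^ 2 / 2))]) hb
  rw [sq_abs] at hsq
  refine hsq.trans ?_
  have hfac : (n.factorial : ℝ) = Stirling.stirlingSeq n * (2 * R) * (n / Real.exp 1) ^ n := by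
    have h2R : Real.sqrt (2 * n : ℝ) = 2 * R := by
      rw [Real.sqrt_eq_iff_mul_self_eq (by positivity) (by positivity)]
      linear_combination (-4) * hR2
    rw [Stirling.stirlingSeq, h2R]
    field_simp
  have hexp : Real.exp (R ^ 2) ^ 2 = Real.exp 1 ^ n := by
    rw [← Real.exp_nat_mul, ← Real.exp_nat_mul, hR2]; congr 1; push_cast; ring
  have hRn : ((R ^ n)⁻¹) ^ 2 = 2 ^ n * ((n : ℝ) ^ n)⁻¹ := by
    rw [inv_pow, ← pow_mul, mul_comm n 2, pow_mul, hR2, div_pow, inv_div]; rfl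
  have hS0 : 0 ≤ Stirling.stirlingSeq n := by
    rw [Stirling.stirlingSeq]; positivity
  have hspi : (1.7724 : ℝ) ≤ Real.sqrt Real.pi := by
    apply Real.le_sqrt_of_sq_le; norm_num; linarith
  have hnum : 2 * Stirling.stirlingSeq n * K0 ^ 2 ≤ Real.sqrt Real.pi * Real.pi ^ 2 := by
    calc 2 * Stirling.stirlingSeq n * K0 ^ 2 ≤ 2 * 1.8225 * 2.1604 ^ 2 := by gcongr
      _ ≤ 1.7724 * 3.1415 ^ 2 := by norm_num
      _ ≤ _ := by gcongr
  have hfin : (n.factorial * (R ^ n)⁻¹ * Real.exp (R ^ 2) * (r * K0 / Real.pi)) ^ 2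
      = 2 ^ n * n.factorial * (2 * Stirling.stirlingSeq n * K0 ^ 2 / Real.pi ^ 2) := by
    have hc : (n.factorial : ℝ) * ((n : ℝ) ^ n)⁻¹ * Real.exp 1 ^ n
        = Stirling.stirlingSeq n * (2 * R) := by
      rw [hfac, div_pow]; field_simp
    calc (n.factorial * (R ^ n)⁻¹ * Real.exp (R ^ 2) * (r * K0 / Real.pi)) ^ 2
        = n.factorial * (n.factorial * ((R ^ n)⁻¹) ^ 2 * Real.exp (R ^ 2) ^ 2)
          * (r ^ 2 * (K0 ^ 2 / Real.pi ^ 2)) := by ring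
      _ = 2 ^ n * n.factorial * ((n.factorial : ℝ) * ((n : ℝ) ^ n)⁻¹ * Real.exp 1 ^ n)
          * (r ^ 2 * (K0 ^ 2 / Real.pi ^ 2)) := by rw [hRn, hexp]; ring
      _ = 2 ^ n * n.factorial * (2 * Stirling.stirlingSeq n) * (r ^ 2 * R)
          * (K0 ^ 2 / Real.pi ^ 2) := by rw [hc]; ring
      _ = _ := by rw [hrR]; ring
  rw [hfin]
  refine mul_le_mul_of_nonneg_left ?_ (by positivity)
  rw [div_le_iff₀ (by positivity)]
  exact hnum

theorem hermite_bound (n : ℕ) (x : ℝ) :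
    |normHermite n x| * Real.exp (-x ^ 2 / 2) ≤ 1 := by
  rcases le_or_gt 3 n with hn | hn
  · exact hermite_bound_large n hn x
  have hspi : (1.7724 : ℝ) ≤ Real.sqrt Real.pi := by
    apply Real.le_sqrt_of_sq_le; norm_num; linarith [Real.pi_gt_d4]
  have he : Real.exp (-x ^ 2 / 2) ^ 2 = (Real.exp (x ^ 2))⁻¹ := by
    rw [← Real.exp_neg, ← Real.exp_nat_mul]; congr 1; push_cast; ring
  have hx := sq_nonneg x
  have hexp := Real.sum_le_exp_of_nonneg hx 5
  simp only [Finset.sum_range_succ, Finset.sum_range_zero] at hexp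
  norm_num [Nat.factorial] at hexp
  apply bound_of_sq
  rw [mul_pow, he, mul_inv_le_iff₀ (Real.exp_pos _)]
  set t := x ^ 2 with ht
  have ht2 : x ^ 4 = t ^ 2 := by rw [ht]; ring
  have hE1 : 1 ≤ Real.exp t := Real.one_le_exp hx
  interval_cases n
  · rw [physHermite_zero]; norm_num
    nlinarith
  · rw [physHermite_one, mul_pow, ← ht]; norm_num
    have : t + 1 ≤ Real.exp t := Real.add_one_le_exp t
    have h2 : 1.7724 * Real.exp t ≤ Real.sqrt Real.pi * Real.exp t := by gcongr
    nlinarith [mul_nonneg hx hx, mul_nonneg hx (mul_nonneg hx hx), sq_nonneg (t - 1), sq_nonneg (t ^ 2)]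
  · rw [physHermite_two, ← ht]; norm_num
    have h2 : 1.7724 * Real.exp t ≤ Real.sqrt Real.pi * Real.exp t := by gcongr
    nlinarith [mul_nonneg hx hx, mul_nonneg hx (mul_nonneg hx hx), sq_nonneg (t ^ 2 - 2 * t), sq_nonneg (t ^ 2 - 3 * t), sq_nonneg (t - 1), sq_nonneg (t - 2), sq_nonneg (t ^ 2), mul_nonneg hx (sq_nonneg (t - 2)), mul_nonneg hx (sq_nonneg (t - 3))]

/-- `O(k^{−1/2})` decay of Hermite–Fourier coefficients:
`|∫ g H̄_k e^{−u²/2}| ≤ (2k+2)^{−1/2} ∫ |g' − u g|`. -/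
theorem stmt_10 (k : ℕ) (g : ℝ → ℝ) (hg : ContDiff ℝ 1 g)
    (hbdd : ∃ C : ℝ, ∀ u : ℝ, |g u| ≤ C)
    (hlim_top : Tendsto (fun u => g u * Real.exp (-u ^ 2 / 2) * normHermite (k + 1) u)
      atTop (nhds 0))
    (hlim_bot : Tendsto (fun u => g u * Real.exp (-u ^ 2 / 2) * normHermite (k + 1) u)
      atBot (nhds 0))
    (hint : Integrable (fun u => |deriv g u - u * g u|))
    (hint1 : Integrable (fun u => g u * normHermite k u * Real.exp (-u ^ 2 / 2))) :
    |∫ u : ℝ, g u * normHermite k u * Real.exp (-u ^ 2 / 2)|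
      ≤ (Real.sqrt (2 * k + 2))⁻¹ * ∫ u : ℝ, |deriv g u - u * g u| := by
  exact main_of_bound k g hg (hermite_bound (k + 1)) hlim_top hlim_bot hint hint1
end
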